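/- arXiv:2205.14842 — 6 statements merged into one kernel-verified Lean document; each statement's English description precedes it below -/
import Mathlib

section
/- Let Π be a nonempty finite set, V L : Π → ℝ, Δ p ε : ℝ with Δ < 0, p ≥ 0, ε ≥ 0, and define V̂(π) = V(π) − Δ·p·L(π). Suppose V is monotonically increasing with L, i.e., for all π₁ π₂ ∈ Π, V(π₁) ≥ V(π₂) if and only if L(π₁) ≥ L(π₂). Then every π₀ ∈ Π with V̂(π₀) ≥ max_{π∈Π} V̂(π) − ε satisfies V(π₀) ≥ max_{π∈Π} V(π) − ε. -/
/-- Lemma 1, case (ii), increasing case: if `V` is monotonically increasing with `L`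
and `Δ < 0`, then every `ε`-optimal policy in the adversarial environment
`V̂(π) = V(π) − Δ·p·L(π)` is also `ε`-optimal in the true environment. -/
theorem ur_attack_trivial_increasing {P : Type*} [Fintype P] [Nonempty P]
    (V L : P → ℝ) (Δ p ε : ℝ) (hΔ : Δ < 0) (hp : 0 ≤ p) (hε : 0 ≤ ε)
    (Vhat : P → ℝ) (hVhat : ∀ π, Vhat π = V π - Δ * p * L π)
    (hmono : ∀ π₁ π₂ : P, V π₁ ≥ V π₂ ↔ L π₁ ≥ L π₂)
    (π₀ : P)
    (h₀ : Vhat π₀ ≥ Finset.univ.sup' Finset.univ_nonempty Vhat - ε) :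
    V π₀ ≥ Finset.univ.sup' Finset.univ_nonempty V - ε := by
  rw [ge_iff_le, sub_le_iff_le_add]
  refine Finset.sup'_le _ _ fun π hπ => ?_
  rcases le_total (V π) (V π₀) with hV | hV
  · linarith
  · have hL : L π₀ ≤ L π := (hmono π π₀).mp hV
    have hle : Vhat π ≤ Finset.univ.sup' Finset.univ_nonempty Vhat := Finset.le_sup' Vhat hπ
    have hcorr : Δ * p * L π ≤ Δ * p * L π₀ :=
      mul_le_mul_of_nonpos_left hL (mul_nonpos_of_nonpos_of_nonneg hΔ.le hp)
    rw [hVhat] at h₀ hle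
    linarith
end

section
/- Let Π be a nonempty finite set, V L : Π → ℝ, Δ p ε : ℝ with Δ > 0, p ≥ 0, ε ≥ 0, and define V̂(π) = V(π) − Δ·p·L(π). Suppose V is monotonically decreasing with L, i.e., for all π₁ π₂ ∈ Π, V(π₁) ≥ V(π₂) if and only if L(π₁) ≤ L(π₂). Then every π₀ ∈ Π with V̂(π₀) ≥ max_{π∈Π} V̂(π) − ε satisfies V(π₀) ≥ max_{π∈Π} V(π) − ε. -/
/-- Lemma 1, case (ii), decreasing case: if `V` is monotonically decreasing with `L`
and `Δ > 0`, then every `ε`-optimal policy in the adversarial environment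
`V̂(π) = V(π) − Δ·p·L(π)` is also `ε`-optimal in the true environment. -/
theorem ur_attack_trivial_decreasing {P : Type*} [Fintype P] [Nonempty P]
    (V L : P → ℝ) (Δ p ε : ℝ) (hΔ : 0 < Δ) (hp : 0 ≤ p) (hε : 0 ≤ ε)
    (Vhat : P → ℝ) (hVhat : ∀ π, Vhat π = V π - Δ * p * L π)
    (hmono : ∀ π₁ π₂ : P, V π₁ ≥ V π₂ ↔ L π₁ ≤ L π₂)
    (π₀ : P)
    (h₀ : Vhat π₀ ≥ Finset.univ.sup' Finset.univ_nonempty Vhat - ε) :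
    V π₀ ≥ Finset.univ.sup' Finset.univ_nonempty V - ε := by
  rw [ge_iff_le, sub_le_iff_le_add]
  refine Finset.sup'_le _ _ fun π _ => ?_
  have hle : Vhat π ≤ Finset.univ.sup' Finset.univ_nonempty Vhat :=
    Finset.le_sup' Vhat (Finset.mem_univ π)
  rcases le_total (V π) (V π₀) with h | h
  · linarith
  · have hL : Δ * p * L π ≤ Δ * p * L π₀ :=
      mul_le_mul_of_nonneg_left ((hmono π π₀).1 h) (mul_nonneg hΔ.le hp)
    linarith [hVhat π, hVhat π₀]
end

section
/- Let Π be a nonempty finite set, V L D : Π → ℝ with 0 ≤ D(π) ≤ L(π) for all π, let Δ ε : ℝ with Δ > 0 and ε ≥ 0, and define V̂(π) = V(π) − Δ·(L(π) − D(π)). Let F = {π ∈ Π : D(π) = L(π)} be nonempty and let π̂* ∈ F satisfy V(π̂*) = max_{π∈F} V(π). Suppose for every π ∈ Π with D(π) < L(π) it holds that V(π̂*) − ε > V(π) − Δ·(L(π) − D(π)). Then every π₀ ∈ Π with V̂(π₀) ≥ max_{π∈Π} V̂(π) − ε satisfies V(π₀) ≤ V(π̂*). -/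
/-- Theorem 2, value bound: under the AE attack with sufficiently large penalty
`Δ`, every `ε`-optimal policy `π₀` of the adversarial environment satisfies
`V(π₀) ≤ V(π̂*)`. -/
theorem ae_attack_value_bound {P : Type*} [Fintype P] [Nonempty P]
    (V L D : P → ℝ) (hD : ∀ π, 0 ≤ D π ∧ D π ≤ L π)
    (Δ ε : ℝ) (hΔ : 0 < Δ) (hε : 0 ≤ ε)
    (Vhat : P → ℝ) (hVhat : ∀ π, Vhat π = V π - Δ * (L π - D π))
    (F : Finset P) (hF : F = Finset.univ.filter (fun π => D π = L π))
    (hFne : F.Nonempty)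
    (πstar : P) (hπstarF : πstar ∈ F)
    (hπstar : V πstar = F.sup' hFne V)
    (hbig : ∀ π : P, D π < L π → V πstar - ε > V π - Δ * (L π - D π))
    (π₀ : P)
    (h₀ : Vhat π₀ ≥ Finset.univ.sup' Finset.univ_nonempty Vhat - ε) :
    V π₀ ≤ V πstar := by
  have hstar : D πstar = L πstar := by simpa [hF] using hπstarF
  have hmax : Vhat πstar ≤ Finset.univ.sup' Finset.univ_nonempty Vhat :=
    Finset.le_sup' Vhat (Finset.mem_univ πstar)
  rw [hVhat πstar, hstar, sub_self, mul_zero, sub_zero] at hmax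
  rw [hVhat π₀] at h₀
  rcases (hD π₀).2.lt_or_eq with hlt | heq
  · linarith [hbig π₀ hlt]
  · rw [hπstar]
    exact Finset.le_sup' V (by simp [hF, heq])
end

section
/- Let S be a type, A a metric space, T a natural number, s : Fin T → S and a : Fin T → A sequences of visited states and taken actions, π̂* π† : S → A maps, and r r₀ δ : ℝ with r₀ > 0 and δ ≥ 0. Suppose dist(π̂*(x), π†(x)) ≥ r + r₀ for every x ∈ S, and ∑_{t=0}^{T−1} dist(a(t), π̂*(s(t))) ≤ δ·T. Then the number of timesteps t with dist(a(t), π†(s(t))) ≤ r is at most (δ/r₀)·T. -/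
/-- Theorem 2, corruption-count bound for the AE attack: if at every state the
adversarial-optimal action is at distance at least `r + r₀` from the target
policy's action, and the agent's total distance to the adversarial-optimal
actions is at most `δ·T`, then the attack corrupts (i.e. the agent's action is
within distance `r` of the target action) at most `(δ/r₀)·T` timesteps. -/
theorem ae_attack_corruption_bound {S A : Type*} [MetricSpace A] (T : ℕ)
    (s : Fin T → S) (a : Fin T → A) (πstar πdag : S → A)
    (r r₀ δ : ℝ) (hr₀ : 0 < r₀) (hδ : 0 ≤ δ)
    (hfar : ∀ x : S, dist (πstar x) (πdag x) ≥ r + r₀)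
    (hlearn : ∑ t : Fin T, dist (a t) (πstar (s t)) ≤ δ * T) :
    ((Finset.univ.filter (fun t : Fin T => dist (a t) (πdag (s t)) ≤ r)).card : ℝ)
      ≤ (δ / r₀) * T := by
  rw [div_mul_eq_mul_div, le_div_iff₀ hr₀]
  refine le_trans ?_ hlearn
  rw [← nsmul_eq_mul]
  refine (Finset.card_nsmul_le_sum _ (fun t => dist (a t) (πstar (s t))) r₀ ?_).trans
    (Finset.sum_le_sum_of_subset_of_nonneg (Finset.filter_subset _ _)
      fun _ _ _ => dist_nonneg)
  intro t ht
  have hclose := (Finset.mem_filter.mp ht).2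
  have htriangle := dist_triangle_left (πstar (s t)) (πdag (s t)) (a t)
  linarith [hfar (s t)]
end

section
/- Let Π be a nonempty finite set, V D : Π → ℝ with D(π) ≥ 0 for all π, let Δ ε : ℝ with Δ > 0 and ε ≥ 0, and define V̂(π) = V(π) − Δ·D(π). Let N = {π ∈ Π : D(π) = 0} be nonempty and let π̂* ∈ N satisfy V(π̂*) = max_{π∈N} V(π). Suppose for every π ∈ Π with D(π) > 0 it holds that V(π̂*) − ε > V(π) − Δ·D(π). Then every π₀ ∈ Π with V̂(π₀) ≥ max_{π∈Π} V̂(π) − ε satisfies V(π₀) ≤ V(π̂*). -/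
/-- Theorem 3, value bound: under the AI attack with sufficiently large penalty
`Δ`, every `ε`-optimal policy `π₀` of the adversarial environment satisfies
`V(π₀) ≤ V(π̂*)`. -/
theorem ai_attack_value_bound {P : Type*} [Fintype P] [Nonempty P]
    (V D : P → ℝ) (hD : ∀ π, 0 ≤ D π)
    (Δ ε : ℝ) (hΔ : 0 < Δ) (hε : 0 ≤ ε)
    (Vhat : P → ℝ) (hVhat : ∀ π, Vhat π = V π - Δ * D π)
    (N : Finset P) (hN : N = Finset.univ.filter (fun π => D π = 0))
    (hNne : N.Nonempty)
    (πstar : P) (hπstarN : πstar ∈ N)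
    (hπstar : V πstar = N.sup' hNne V)
    (hbig : ∀ π : P, 0 < D π → V πstar - ε > V π - Δ * D π)
    (π₀ : P)
    (h₀ : Vhat π₀ ≥ Finset.univ.sup' Finset.univ_nonempty Vhat - ε) :
    V π₀ ≤ V πstar := by
  have hmem : ∀ π, π ∈ N ↔ D π = 0 := by simp [hN]
  have hle : Vhat πstar ≤ Finset.univ.sup' Finset.univ_nonempty Vhat :=
    Finset.le_sup' Vhat (Finset.mem_univ πstar)
  have hstar : Vhat πstar = V πstar := by simp [hVhat, (hmem πstar).1 hπstarN]
  rcases (hD π₀).eq_or_lt with h | h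
  · rw [hπstar]
    exact Finset.le_sup' V ((hmem π₀).2 h.symm)
  · linarith [hbig π₀ h, hVhat π₀]
end

section
/- Let S be a type, A a metric space, T a natural number, s : Fin T → S and a : Fin T → A sequences of visited states and taken actions, π̂* π† : S → A maps, and r r₀ δ : ℝ with r₀ > 0 and δ ≥ 0. Suppose dist(π̂*(x), π†(x)) ≤ r − r₀ for every x ∈ S, and ∑_{t=0}^{T−1} dist(a(t), π̂*(s(t))) ≤ δ·T. Then the number of timesteps t with dist(a(t), π†(s(t))) > r is at most (δ/r₀)·T. -/
/-- Theorem 3, corruption-count bound for the AI attack: if at every state the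
adversarial-optimal action is at distance at most `r − r₀` from the target
policy's action, and the agent's total distance to the adversarial-optimal
actions is at most `δ·T`, then the attack corrupts (i.e. the agent's action is
at distance more than `r` from the target action) at most `(δ/r₀)·T` timesteps. -/
theorem ai_attack_corruption_bound {S A : Type*} [MetricSpace A] (T : ℕ)
    (s : Fin T → S) (a : Fin T → A) (πstar πdag : S → A)
    (r r₀ δ : ℝ) (hr₀ : 0 < r₀) (hδ : 0 ≤ δ)
    (hclose : ∀ x : S, dist (πstar x) (πdag x) ≤ r - r₀)
    (hlearn : ∑ t : Fin T, dist (a t) (πstar (s t)) ≤ δ * T) :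
    ((Finset.univ.filter (fun t : Fin T => dist (a t) (πdag (s t)) > r)).card : ℝ)
      ≤ (δ / r₀) * T := by
  rw [div_mul_eq_mul_div, le_div_iff₀ hr₀, ← nsmul_eq_mul]
  refine le_trans ?_ hlearn
  refine (Finset.card_nsmul_le_sum _ (fun t => dist (a t) (πstar (s t))) r₀ ?_).trans
    (Finset.sum_le_sum_of_subset_of_nonneg (Finset.filter_subset _ _)
      fun _ _ _ => dist_nonneg)
  intro t ht
  have hfar := (Finset.mem_filter.mp ht).2
  linarith [dist_triangle (a t) (πstar (s t)) (πdag (s t)), hclose (s t)]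
end
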